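/- Let (G, H) be a mixed graph with G connected on a nonempty finite vertex type, and suppose every cycle of G has γ-weight 1 (X is γ-monostore). Then H has the same spectrum as the adjacency matrix of the underlying graph G; equivalently, the characteristic polynomial of H equals the characteristic polynomial of the 0-1 adjacency matrix A(G) of G (viewed over ℂ). -/

import Mathlib

open Matrix Complex BigOperators

noncomputable def gamma : ℂ := Complex.exp (2 * Real.pi * Complex.I / 3)

/-- The γ-weight of a walk: the product of the entries of `H` along its edges. -/
def walkWeight {V : Type*} {G : SimpleGraph V} (H : Matrix V V ℂ) :
    {u v : V} → G.Walk u v → ℂ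
  | _, _, SimpleGraph.Walk.nil => 1
  | _, _, @SimpleGraph.Walk.cons _ _ u x _ _ p => H u x * walkWeight H p

lemma norm_gamma : ‖gamma‖ = 1 := by
  have h : (2 * Real.pi * Complex.I / 3 : ℂ) = ((2 * Real.pi / 3 : ℝ) : ℂ) * Complex.I := by
    push_cast
    ring
  rw [gamma, h, Complex.norm_exp_ofReal_mul_I]

lemma norm_eq_one_of_mem_gamma_powers {z : ℂ} (hz : z ∈ ({1, gamma, gamma ^ 2} : Set ℂ)) :
    ‖z‖ = 1 := by
  rcases hz with rfl | rfl | rfl <;> simp [norm_gamma]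

lemma Matrix.IsHermitian.mul_apply_swap_eq_one {V : Type*} {H : Matrix V V ℂ}
    (hH : H.IsHermitian) {u v : V} (h : ‖H u v‖ = 1) : H u v * H v u = 1 := by
  rw [← hH.apply v u]
  simp [Complex.mul_conj, Complex.normSq_eq_norm_sq, h]

section WalkWeight

variable {V : Type*} {G : SimpleGraph V} (H : Matrix V V ℂ)

lemma walkWeight_append {u v w : V} (p : G.Walk u v) (q : G.Walk v w) :
    walkWeight H (p.append q) = walkWeight H p * walkWeight H q := by
  induction p with
  | nil => simp [walkWeight]
  | cons h p ih => simp [walkWeight, ih, mul_assoc]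

/-- An edge followed by a path back to its start is either a cycle or a backtrack, so it has
weight 1 as soon as all cycles and all backtracks do. -/
lemma walkWeight_cons_of_isPath
    (hback : ∀ u v, G.Adj u v → H u v * H v u = 1)
    (hcycle : ∀ (v : V) (w : G.Walk v v), w.IsCycle → walkWeight H w = 1)
    {u v : V} (h : G.Adj u v) (p : G.Walk v u) (hp : p.IsPath) :
    walkWeight H (SimpleGraph.Walk.cons h p) = 1 := by
  by_cases he : s(u, v) ∈ p.edges
  · cases p with
    | nil => exact (h.ne rfl).elim
    | @cons _ y _ h' r =>
      rw [SimpleGraph.Walk.cons_isPath_iff] at hp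
      rw [SimpleGraph.Walk.edges_cons, List.mem_cons] at he
      rcases he with he | he
      · obtain rfl : u = y := by
          rw [Sym2.eq_swap] at he
          exact Sym2.congr_right.mp he
        obtain rfl := (SimpleGraph.Walk.isPath_iff_nil.mp hp.1).eq_nil
        simpa [walkWeight] using hback _ _ h
      · exact (hp.2 (r.snd_mem_support_of_mem_edges he)).elim
  · exact hcycle _ _ ((SimpleGraph.Walk.cons_isCycle_iff p h).mpr ⟨hp, he⟩)

lemma walkWeight_bypass [DecidableEq V]
    (hback : ∀ u v, G.Adj u v → H u v * H v u = 1)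
    (hcycle : ∀ (v : V) (w : G.Walk v v), w.IsCycle → walkWeight H w = 1)
    {u v : V} (p : G.Walk u v) : walkWeight H p.bypass = walkWeight H p := by
  induction p with
  | nil => rfl
  | @cons u x _ h p ih =>
    by_cases hs : u ∈ p.bypass.support
    · have hc := walkWeight_cons_of_isPath H hback hcycle h (p.bypass.takeUntil u hs)
        (p.bypass_isPath.takeUntil hs)
      have ha := walkWeight_append H (p.bypass.takeUntil u hs) (p.bypass.dropUntil u hs)
      rw [SimpleGraph.Walk.take_spec, ih] at ha
      simp only [SimpleGraph.Walk.bypass, dif_pos hs, walkWeight] at hc ⊢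
      rw [ha, ← mul_assoc, hc, one_mul]
    · simp only [SimpleGraph.Walk.bypass, dif_neg hs, walkWeight, ih]

lemma walkWeight_closed
    (hback : ∀ u v, G.Adj u v → H u v * H v u = 1)
    (hcycle : ∀ (v : V) (w : G.Walk v v), w.IsCycle → walkWeight H w = 1)
    {v : V} (p : G.Walk v v) : walkWeight H p = 1 := by
  classical
  rw [← walkWeight_bypass H hback hcycle,
    (SimpleGraph.Walk.isPath_iff_nil.mp p.bypass_isPath).eq_nil, walkWeight]

end WalkWeight

lemma Matrix.charpoly_eq_of_diagonal_mul_eq {V R : Type*} [Fintype V] [DecidableEq V]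
    [CommRing R] {A B : Matrix V V R} (d : V → R) (hd : ∀ v, IsUnit (d v))
    (h : diagonal d * A = B * diagonal d) : A.charpoly = B.charpoly := by
  obtain ⟨D, hD⟩ := Matrix.isUnit_diagonal.mpr (Pi.isUnit_iff.mpr hd)
  rw [← hD] at h
  rw [← Matrix.charpoly_units_conj D A, h, ← Matrix.coe_units_inv,
    Units.mul_inv_cancel_right]

/-- A connected γ-monostore mixed graph is cospectral with its underlying graph:
the characteristic polynomial of `H` equals that of the 0-1 adjacency matrix of `G`. -/
theorem monostore_charpoly_eq_adjMatrix {V : Type*} [Fintype V] [DecidableEq V] [Nonempty V]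
    (G : SimpleGraph V) [DecidableRel G.Adj] (hconn : G.Preconnected)
    (H : Matrix V V ℂ) (hH : H.IsHermitian)
    (hadj : ∀ u v, G.Adj u v → H u v ∈ ({1, gamma, gamma ^ 2} : Set ℂ))
    (hnadj : ∀ u v, ¬ G.Adj u v → H u v = 0)
    (hmono : ∀ (v : V) (w : G.Walk v v), w.IsCycle → walkWeight H w = 1) :
    H.charpoly = (G.adjMatrix ℂ).charpoly := by
  have hback : ∀ u v, G.Adj u v → H u v * H v u = 1 := fun u v h =>
    hH.mul_apply_swap_eq_one (norm_eq_one_of_mem_gamma_powers (hadj u v h))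
  have hclosed : ∀ {v : V} (p : G.Walk v v), walkWeight H p = 1 :=
    walkWeight_closed H hback hmono
  let r : V := Classical.arbitrary V
  let p : ∀ v, G.Walk r v := fun v => (hconn r v).some
  have hrev : ∀ v, walkWeight H (p v) * walkWeight H (p v).reverse = 1 := fun v => by
    rw [← walkWeight_append, hclosed]
  refine Matrix.charpoly_eq_of_diagonal_mul_eq (fun v => walkWeight H (p v))
    (fun v => IsUnit.of_mul_eq_one _ (hrev v)) ?_
  ext u v
  rw [Matrix.diagonal_mul, Matrix.mul_diagonal, SimpleGraph.adjMatrix_apply]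
  split_ifs with h
  · have hc := hclosed ((p u).append (SimpleGraph.Walk.cons h (p v).reverse))
    rw [walkWeight_append, walkWeight] at hc
    linear_combination walkWeight H (p v) * hc - walkWeight H (p u) * H u v * hrev v
  · simp [hnadj u v h]
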